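/- arXiv:1107.3793 — 2 statements merged into one kernel-verified Lean document; each statement's English description precedes it below -/
import Mathlib

section
/- Every m×n matrix A over ℤ/2 with rank r admits a decomposition A = Q·S·U, where Q is an m×m permutation matrix, U is an n×n upper unitriangular matrix (upper triangular with all diagonal entries equal to 1), and S is an m×n matrix with exactly r nonzero columns, these nonzero columns being linearly independent; moreover, the r×r matrix obtained from S by deleting all zero columns and the lowest m−r rows is lower unitriangular. -/
namespace Matrix

variable {K : Type*} [Field K] {m n : ℕ}

/-- Column data of an echelon-like matrix: the nonzero columns of `S` are exactly those listed by
`c`, and its top square block on these columns is lower triangular with nonzero diagonal. -/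
structure IsLowerPivoted {r : ℕ} (S : Matrix (Fin m) (Fin n) K) (c : Fin r → Fin n)
    (hrm : r ≤ m) : Prop where
  strictMono : StrictMono c
  col_ne_zero_iff (j : Fin n) : (fun i => S i j) ≠ 0 ↔ j ∈ Set.range c
  diag_ne_zero (k : Fin r) : S (Fin.castLE hrm k) (c k) ≠ 0
  eq_zero_of_lt (k l : Fin r) : k < l → S (Fin.castLE hrm k) (c l) = 0

namespace IsLowerPivoted

variable {r : ℕ} {S : Matrix (Fin m) (Fin n) K} {c : Fin r → Fin n} {hrm : r ≤ m}

theorem det_ne_zero (h : S.IsLowerPivoted c hrm) :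
    (S.submatrix (Fin.castLE hrm) c).det ≠ 0 := by
  rw [det_of_isLowerTriangular]
  · exact Finset.prod_ne_zero_iff.mpr fun k _ => h.diag_ne_zero k
  · intro k l hkl
    exact h.eq_zero_of_lt k l (by simpa using hkl)

theorem linearIndependent (h : S.IsLowerPivoted c hrm) :
    LinearIndependent K (fun k : Fin r => fun i : Fin m => S i (c k)) :=
  (linearIndependent_cols_of_det_ne_zero h.det_ne_zero).of_comp
    (LinearMap.funLeft K K (Fin.castLE hrm))

theorem rank_eq (h : S.IsLowerPivoted c hrm) : S.rank = r := by
  have hspan : Submodule.span K (Set.range S.col) =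
      Submodule.span K (Set.range fun k : Fin r => fun i : Fin m => S i (c k)) := by
    apply le_antisymm
    · rw [Submodule.span_le]
      rintro _ ⟨j, rfl⟩
      by_cases hj : (fun i => S i j) = 0
      · rw [show S.col j = 0 from hj]
        exact Submodule.zero_mem _
      · obtain ⟨k, rfl⟩ := (h.col_ne_zero_iff j).mp hj
        exact Submodule.subset_span ⟨k, rfl⟩
    · apply Submodule.span_mono
      rintro _ ⟨k, rfl⟩
      exact ⟨c k, rfl⟩
  rw [rank_eq_finrank_span_cols, hspan, finrank_span_eq_card h.linearIndependent,
    Fintype.card_fin]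

theorem exists_mulVec_eq (h : S.IsLowerPivoted c hrm) (w : Fin m → K) :
    ∃ x, ∀ k : Fin r, (S *ᵥ x) (Fin.castLE hrm k) = w (Fin.castLE hrm k) := by
  obtain ⟨y, hy⟩ := mulVec_surjective_iff_isUnit.mpr
    ((isUnit_iff_isUnit_det _).mpr h.det_ne_zero.isUnit) (w ∘ Fin.castLE hrm)
  refine ⟨(1 : Matrix (Fin n) (Fin n) K).submatrix id c *ᵥ y, fun k => ?_⟩
  have hS : S * (1 : Matrix (Fin n) (Fin n) K).submatrix id c = S.submatrix id c := by
    ext i j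
    simp [mul_apply, one_apply]
  rw [mulVec_mulVec, hS]
  exact congrFun hy k

theorem snoc_zero (h : S.IsLowerPivoted c hrm) :
    IsLowerPivoted (of fun i => Fin.snoc (α := fun _ => K) (S i) 0)
      (Fin.castSucc ∘ c) hrm where
  strictMono := (Fin.strictMono_castSucc).comp h.strictMono
  col_ne_zero_iff j := by
    refine Fin.lastCases ?_ (fun j => ?_) j
    · simp [funext_iff, Fin.castSucc_ne_last]
    · simpa using h.col_ne_zero_iff j
  diag_ne_zero k := by simpa using h.diag_ne_zero k
  eq_zero_of_lt k l hkl := by simpa using h.eq_zero_of_lt k l hkl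

theorem snoc_swap (h : S.IsLowerPivoted c hrm) {w : Fin m → K}
    (hw : ∀ k : Fin r, w (Fin.castLE hrm k) = 0) {p : Fin m} (hp : w p ≠ 0) (hr : r < m) :
    IsLowerPivoted ((of fun i => Fin.snoc (α := fun _ => K) (S i) (w i)).submatrix
      (Equiv.swap ⟨r, hr⟩ p) id)
      (Fin.snoc (α := fun _ => Fin (n + 1)) (Fin.castSucc ∘ c) (Fin.last n)) hr := by
  have hrp : r ≤ p := by
    by_contra! hlt
    exact hp (hw ⟨p, hlt⟩)
  have hlow (k : Fin r) : Equiv.swap ⟨r, hr⟩ p (Fin.castLE hrm k) = Fin.castLE hrm k := by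
    apply Equiv.swap_apply_of_ne_of_ne <;> simp only [ne_eq, Fin.ext_iff, Fin.val_castLE] <;> omega
  have hlast : Equiv.swap ⟨r, hr⟩ p (Fin.castLE hr (Fin.last r)) = p :=
    Equiv.swap_apply_left _ _
  refine ⟨?_, fun j => ?_, fun k => ?_, fun k l => ?_⟩
  · intro a b
    refine Fin.lastCases ?_ (fun a => ?_) a <;> refine Fin.lastCases ?_ (fun b => ?_) b
    · simp
    · intro hab
      exact absurd hab (Fin.castSucc_lt_last b).not_gt
    · simp [Fin.castSucc_lt_last]
    · simpa using fun hab => h.strictMono hab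
  · refine Fin.lastCases ?_ (fun j => ?_) j
    · refine iff_of_true (fun h0 => hp ?_) ⟨Fin.last r, by simp⟩
      simpa using congrFun h0 ⟨r, hr⟩
    · have hcol : (fun i => S (Equiv.swap ⟨r, hr⟩ p i) j) = 0 ↔ (fun i => S i j) = 0 := by
        simp only [funext_iff, Pi.zero_apply]
        exact (Equiv.swap ⟨r, hr⟩ p).forall_congr_left.trans (by simp)
      have hrange : (∃ k, Fin.snoc (α := fun _ => Fin (n + 1)) (Fin.castSucc ∘ c) (Fin.last n) k
          = j.castSucc) ↔ j ∈ Set.range c := by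
        simp [Fin.exists_fin_succ', (Fin.castSucc_ne_last j).symm]
      rw [Set.mem_range, hrange, ← h.col_ne_zero_iff j]
      simpa using hcol.not
  · refine Fin.lastCases ?_ (fun k => ?_) k
    · simpa [hlast] using hp
    · simpa [hlow] using h.diag_ne_zero k
  · refine Fin.lastCases ?_ (fun k => ?_) k <;> refine Fin.lastCases ?_ (fun l => ?_) l
    · simp
    · intro hkl
      exact absurd hkl (Fin.castSucc_lt_last l).not_gt
    · simp [hlow, hw]
    · simpa [hlow] using h.eq_zero_of_lt k l

end IsLowerPivoted

/-- Upper triangular with unit diagonal. -/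
structure IsUpperUnitriangular (U : Matrix (Fin n) (Fin n) K) : Prop where
  eq_zero_of_lt (i j : Fin n) : j < i → U i j = 0
  diag_eq_one (i : Fin n) : U i i = 1

theorem IsUpperUnitriangular.isUnit_det {U : Matrix (Fin n) (Fin n) K}
    (h : U.IsUpperUnitriangular) : IsUnit U.det := by
  rw [det_of_isUpperTriangular fun i j hij => h.eq_zero_of_lt i j hij]
  simp [h.diag_eq_one]

/-- Border a square matrix by the column `x`, a zero row and a corner entry `1`. -/
def snocUnit (U : Matrix (Fin n) (Fin n) K) (x : Fin n → K) :
    Matrix (Fin (n + 1)) (Fin (n + 1)) K :=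
  of (Fin.snoc (α := fun _ => Fin (n + 1) → K)
    (fun i => Fin.snoc (α := fun _ => K) (U i) (x i)) (Fin.snoc (α := fun _ => K) 0 1))

theorem IsUpperUnitriangular.snocUnit {U : Matrix (Fin n) (Fin n) K}
    (h : U.IsUpperUnitriangular) (x : Fin n → K) : (U.snocUnit x).IsUpperUnitriangular where
  eq_zero_of_lt i j := by
    refine Fin.lastCases ?_ (fun i => ?_) i <;> refine Fin.lastCases ?_ (fun j => ?_) j
    · simp
    · simp [Matrix.snocUnit]
    · intro hij
      exact absurd hij (Fin.castSucc_lt_last i).not_gt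
    · simpa [Matrix.snocUnit] using h.eq_zero_of_lt i j
  diag_eq_one i := by
    refine Fin.lastCases ?_ (fun i => ?_) i
    · simp [Matrix.snocUnit]
    · simpa [Matrix.snocUnit] using h.diag_eq_one i

theorem snoc_mul_snocUnit (S : Matrix (Fin m) (Fin n) K) (w : Fin m → K)
    (U : Matrix (Fin n) (Fin n) K) (x : Fin n → K) :
    (of fun i => Fin.snoc (α := fun _ => K) (S i) (w i)) * U.snocUnit x =
      of fun i => Fin.snoc (α := fun _ => K) ((S * U) i) ((S *ᵥ x + w) i) := by
  ext i j
  refine Fin.lastCases ?_ (fun j => ?_) j <;>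
    simp [mul_apply, mulVec, dotProduct, snocUnit, Fin.sum_univ_castSucc]

theorem exists_eq_submatrix_mul (A : Matrix (Fin m) (Fin n) K) :
    ∃ (r : ℕ) (hrm : r ≤ m) (σ : Equiv.Perm (Fin m)) (S : Matrix (Fin m) (Fin n) K)
      (U : Matrix (Fin n) (Fin n) K) (c : Fin r → Fin n),
      A = (S * U).submatrix σ id ∧ U.IsUpperUnitriangular ∧ S.IsLowerPivoted c hrm := by
  induction n with
  | zero =>
    exact ⟨0, m.zero_le, 1, 0, 0, Fin.elim0, Subsingleton.elim _ _,
      ⟨fun i => i.elim0, fun i => i.elim0⟩,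
      ⟨fun i => i.elim0, fun i => i.elim0, fun i => i.elim0, fun i => i.elim0⟩⟩
  | succ n ih =>
    obtain ⟨r, hrm, σ, S, U, c, hA, hU, hS⟩ := ih (A.submatrix id Fin.castSucc)
    set v : Fin m → K := fun i => A (σ.symm i) (Fin.last n) with hv
    obtain ⟨x, hx⟩ := hS.exists_mulVec_eq v
    set w := v - S *ᵥ x with hw
    have hA' : A = ((of fun i => Fin.snoc (α := fun _ => K) (S i) (w i)) *
        U.snocUnit x).submatrix σ id := by
      rw [snoc_mul_snocUnit]
      ext i j
      refine Fin.lastCases ?_ (fun j => ?_) j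
      · simp [hw, hv]
      · simpa using congrFun (congrFun hA i) j
    by_cases hw0 : w = 0
    · refine ⟨r, hrm, σ, _, _, Fin.castSucc ∘ c, hA', hU.snocUnit x, ?_⟩
      simpa only [hw0, Pi.zero_apply] using hS.snoc_zero
    · obtain ⟨p, hp⟩ := Function.ne_iff.mp hw0
      have hwk (k : Fin r) : w (Fin.castLE hrm k) = 0 := by simp [hw, hx]
      have hr : r < m := by
        by_contra! hmr
        exact hp (hwk ⟨p, p.2.trans_le hmr⟩)
      refine ⟨r + 1, hr, Equiv.swap ⟨r, hr⟩ p * σ, _, _, _, ?_, hU.snocUnit x,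
        hS.snoc_swap hwk hp hr⟩
      conv_lhs => rw [hA']
      ext i j
      simp [mul_apply]

end Matrix


/-- LSP-decomposition (column version).  Every `m × n` matrix `A` over `ℤ/2`
of rank `r` can be written as `A = Q * S * U` where `Q` is an `m × m` permutation matrix,
`U` is an `n × n` upper unitriangular matrix, and `S` is an `m × n` matrix with exactly
`r` nonzero columns (enumerated in increasing order by `c : Fin r → Fin n`), these
nonzero columns being linearly independent; moreover the `r × r` matrix obtained from `S`
by deleting the zero columns and the lowest `m - r` rows is lower unitriangular. -/
theorem lsp_decomposition {m n : ℕ} (A : Matrix (Fin m) (Fin n) (ZMod 2))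
    (r : ℕ) (hr : A.rank = r) :
    ∃ (Q : Matrix (Fin m) (Fin m) (ZMod 2)) (S : Matrix (Fin m) (Fin n) (ZMod 2))
      (U : Matrix (Fin n) (Fin n) (ZMod 2)) (σ : Equiv.Perm (Fin m))
      (c : Fin r → Fin n) (hrm : r ≤ m),
      A = Q * S * U ∧
      Q = σ.permMatrix (ZMod 2) ∧
      (∀ i j : Fin n, j < i → U i j = 0) ∧
      (∀ i : Fin n, U i i = 1) ∧
      StrictMono c ∧
      (∀ j : Fin n, (fun i : Fin m => S i j) ≠ 0 ↔ j ∈ Set.range c) ∧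
      LinearIndependent (ZMod 2) (fun k : Fin r => fun i : Fin m => S i (c k)) ∧
      (∀ k : Fin r, S (Fin.castLE hrm k) (c k) = 1) ∧
      (∀ k l : Fin r, k < l → S (Fin.castLE hrm k) (c l) = 0) := by
  obtain ⟨r', hrm, σ, S, U, c, hA, hU, hS⟩ := A.exists_eq_submatrix_mul
  have hrank : A.rank = r' := by
    rw [hA, ← Equiv.coe_refl, Matrix.rank_submatrix,
      Matrix.rank_mul_eq_left_of_isUnit_det _ _ hU.isUnit_det, hS.rank_eq]
  obtain rfl : r' = r := hrank.symm.trans hr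
  refine ⟨σ.permMatrix (ZMod 2), S, U, σ, c, hrm, ?_, rfl, hU.eq_zero_of_lt, hU.diag_eq_one,
    hS.strictMono, hS.col_ne_zero_iff, hS.linearIndependent, fun k => ?_, hS.eq_zero_of_lt⟩
  · rw [Matrix.mul_assoc, Equiv.Perm.permMatrix, PEquiv.toMatrix_toPEquiv_mul, hA]
  · exact Fin.eq_one_of_ne_zero _ (hS.diag_ne_zero k)
end

section
/- Let G be a finite simple graph in which every edge e has a strictly positive real weight w(e), let B be a subspace of the cycle space Z(G), and let g = dim(Z(G)/B). Suppose z ∈ Z(G) has minimum weight among all elements of its coset z + B, and suppose z is the union of pairwise edge-disjoint elementary cycles z_1, …, z_t. Then t ≤ g. -/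
/-- The cycle space of a finite simple graph over `ℤ/2`: edge sets (indicator functions
on `Sym2 V`) supported on edges of `G` in which every vertex is incident to an even
number of edges of the set. -/
def cycleSpace {V : Type*} [Fintype V] [DecidableEq V] (G : SimpleGraph V)
    [DecidableRel G.Adj] : Submodule (ZMod 2) (Sym2 V → ZMod 2) :=
  (⨅ (e : Sym2 V) (_ : e ∉ G.edgeSet),
      LinearMap.ker (LinearMap.proj (R := ZMod 2) (φ := fun _ : Sym2 V => ZMod 2) e)) ⊓
  ⨅ (v : V),
      LinearMap.ker (∑ e ∈ G.edgeFinset.filter (fun e => v ∈ e),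
        LinearMap.proj (R := ZMod 2) (φ := fun _ : Sym2 V => ZMod 2) e)

/-- The weight of an edge set (an indicator function on `Sym2 V`): the sum of the
weights of the edges it contains. -/
def edgeWeight {V : Type*} [Fintype V] [DecidableEq V] (w : Sym2 V → ℝ)
    (z : Sym2 V → ZMod 2) : ℝ :=
  ∑ e ∈ Finset.univ.filter (fun e => z e = 1), w e

theorem mem_cycleSpace_iff {V : Type*} [Fintype V] [DecidableEq V] {G : SimpleGraph V}
    [DecidableRel G.Adj] {z : Sym2 V → ZMod 2} :
    z ∈ cycleSpace G ↔ (∀ e ∉ G.edgeSet, z e = 0) ∧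
      ∀ v, ∑ e ∈ G.edgeFinset.filter (fun e => v ∈ e), z e = 0 := by
  simp [cycleSpace, Submodule.mem_iInf]

/-- The edge set of a closed trail lies in the cycle space. -/
theorem SimpleGraph.Walk.IsTrail.indicator_edges_mem_cycleSpace {V : Type*} [Fintype V]
    [DecidableEq V] {G : SimpleGraph V} [DecidableRel G.Adj] {x : V} {c : G.Walk x x}
    (hc : c.IsTrail) :
    (fun e => if e ∈ c.edges then (1 : ZMod 2) else 0) ∈ cycleSpace G := by
  refine mem_cycleSpace_iff.2 ⟨fun e he => if_neg fun h => he (c.edges_subset_edgeSet h),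
    fun v => ?_⟩
  have heven : Even (c.edges.countP (fun e => v ∈ e)) :=
    (hc.even_countP_edges_iff v).2 fun h => absurd rfl h
  have hcard : ((G.edgeFinset.filter (fun e => v ∈ e)).filter (fun e => e ∈ c.edges)).card =
      c.edges.countP (fun e => v ∈ e) := by
    rw [List.countP_eq_length_filter,
      ← List.toFinset_card_of_nodup (hc.edges_nodup.filter _)]
    congr 1
    ext e
    simp only [Finset.mem_filter, SimpleGraph.mem_edgeFinset, List.mem_toFinset,
      List.mem_filter, decide_eq_true_eq]
    exact ⟨fun h => ⟨h.2, h.1.2⟩, fun h => ⟨⟨c.edges_subset_edgeSet h.1, h.2⟩, h.1⟩⟩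
  rw [Finset.sum_boole, hcard]
  exact (ZMod.natCast_eq_zero_iff_even).2 heven

/-- On the support of one member of a family of pairwise disjoint edge sets, a linear
combination of the family takes the value of the corresponding coefficient. -/
theorem sum_smul_apply_of_disjoint {ι E : Type*} [Fintype ι] {f : ι → E → ZMod 2}
    (hdisj : ∀ i j, i ≠ j → ∀ e, f i e = 1 → f j e = 0) (a : ι → ZMod 2) {i : ι} {e : E}
    (he : f i e = 1) : (∑ j, a j • f j) e = a i := by
  rw [Finset.sum_apply, Finset.sum_eq_single i]
  · simp [he]
  · intro j _ hj
    simp [hdisj i j hj.symm e he]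
  · simp

/-- Passing to a strictly smaller edge set strictly decreases the weight. -/
theorem edgeWeight_lt_of_support_ssubset {V : Type*} [Fintype V] [DecidableEq V]
    {w : Sym2 V → ℝ} {z z' : Sym2 V → ZMod 2} (hw : ∀ e, z e = 1 → 0 < w e)
    (hsub : ∀ e, z' e = 1 → z e = 1) {e : Sym2 V} (he : z e = 1) (he' : z' e ≠ 1) :
    edgeWeight w z' < edgeWeight w z := by
  refine Finset.sum_lt_sum_of_subset (i := e) (fun e h => ?_) (by simpa using he)
    (by simpa using he') (hw e he) (fun j hj _ => (hw j (by simpa using hj)).le)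
  simp only [Finset.mem_filter, Finset.mem_univ, true_and] at h ⊢
  exact hsub e h

/-- let `G` have strictly positive edge weights, `B` a subspace of the
cycle space `Z(G)` and `g = dim (Z(G)/B)`.  If `z ∈ Z(G)` has minimum weight in its
coset `z + B` and `z` is the union of `t` pairwise edge-disjoint elementary cycles
(edge sets of graph cycles of `G`), then `t ≤ g`. -/
theorem min_homologous_cycle_few_elementary {V : Type*} [Fintype V] [DecidableEq V]
    (G : SimpleGraph V) [DecidableRel G.Adj]
    (w : Sym2 V → ℝ) (hw : ∀ e ∈ G.edgeSet, 0 < w e)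
    (B : Submodule (ZMod 2) (Sym2 V → ZMod 2)) (hB : B ≤ cycleSpace G)
    (g : ℕ)
    (hg : Module.finrank (ZMod 2)
      (↥(cycleSpace G) ⧸ Submodule.comap (cycleSpace G).subtype B) = g)
    (z : Sym2 V → ZMod 2) (hz : z ∈ cycleSpace G)
    (hmin : ∀ z' ∈ cycleSpace G, z + z' ∈ B → edgeWeight w z ≤ edgeWeight w z')
    (t : ℕ) (zs : Fin t → (Sym2 V → ZMod 2))
    (helem : ∀ i, ∃ (x : V) (c : G.Walk x x), c.IsCycle ∧
      zs i = fun e => if e ∈ c.edges then (1 : ZMod 2) else 0)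
    (hdisj : ∀ i j, i ≠ j → ∀ e, zs i e = 1 → zs j e = 0)
    (hsum : z = ∑ i, zs i) :
    t ≤ g := by
  have eq_one_of_ne_zero : ∀ a : ZMod 2, a ≠ 0 → a = 1 := by decide
  have hzs (i) : zs i ∈ cycleSpace G := by
    obtain ⟨x, c, hc, h⟩ := helem i
    exact h ▸ hc.isTrail.indicator_edges_mem_cycleSpace
  have hne (i) : ∃ e, zs i e = 1 := by
    obtain ⟨x, c, hc, h⟩ := helem i
    obtain ⟨e, he⟩ := List.exists_mem_of_ne_nil c.edges
      (fun h => hc.not_nil (SimpleGraph.Walk.edges_eq_nil.1 h))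
    exact ⟨e, by simp [h, he]⟩
  have hz_apply {i e} (he : zs i e = 1) : z e = 1 := by
    simpa [hsum] using sum_smul_apply_of_disjoint hdisj 1 he
  have hli : LinearIndependent (ZMod 2) fun i =>
      (Submodule.comap (cycleSpace G).subtype B).mkQ ⟨zs i, hzs i⟩ := by
    rw [Fintype.linearIndependent_iff]
    intro a ha j
    have hb : ∑ i, a i • zs i ∈ B := by
      simp only [← map_smul, ← map_sum] at ha
      rw [Submodule.mkQ_apply, Submodule.Quotient.mk_eq_zero] at ha
      simpa using ha
    by_contra hj
    obtain ⟨e, he⟩ := hne j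
    have hz' : z + ∑ i, a i • zs i = ∑ i, (1 + a i) • zs i := by
      simp [hsum, add_smul, Finset.sum_add_distrib]
    refine (hmin (z + ∑ i, a i • zs i) (add_mem hz (hB hb)) ?_).not_gt
      (edgeWeight_lt_of_support_ssubset (e := e) (fun e h => hw e ?_) (fun e h => ?_)
        (hz_apply he) ?_)
    · rwa [← add_assoc, ZModModule.add_self, zero_add]
    · by_contra hG
      simp [(mem_cycleSpace_iff.1 hz).1 e hG] at h
    · rw [hz', Finset.sum_apply] at h
      obtain ⟨i, -, hi⟩ := Finset.exists_ne_zero_of_sum_ne_zero (h.trans_ne one_ne_zero)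
      exact hz_apply (eq_one_of_ne_zero _ (right_ne_zero_of_mul hi))
    · rw [hz', sum_smul_apply_of_disjoint hdisj _ he, eq_one_of_ne_zero _ hj]
      decide
  simpa [hg] using hli.fintype_card_le_finrank
end
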